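/- arXiv:1503.08589 — 2 statements merged into one kernel-verified Lean document; each statement's English description precedes it below -/
import Mathlib

section
/- Let α ∈ ℝ, C_ρ > 0, ρ < 0, x > 0, σ ∈ ℝ, and set C_θ := max(|α|/C_ρ, 1) and θ := α·(e^{ρx} − 1)/(σ² + C_ρ). If α/(σ² + C_ρ) > −1, then 1 − θ > 0 and |log(1 − θ)| ≤ C_θ·|ρ|·x. -/
/-- If `α/(σ² + C_ρ) > -1`, then `1 - θ > 0` and `|log(1-θ)| ≤ C_θ|ρ|x` for
`θ = α(e^{ρx}-1)/(σ² + C_ρ)` and `C_θ := max(|α|/C_ρ, 1)`. -/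
theorem stmt_7 (α Cρ ρ x σ : ℝ) (hCρ : 0 < Cρ) (hρ : ρ < 0) (hx : 0 < x)
    (Cθ θ : ℝ) (hCθ : Cθ = max (|α| / Cρ) 1)
    (hθ : θ = α * (Real.exp (ρ * x) - 1) / (σ ^ 2 + Cρ))
    (h : α / (σ ^ 2 + Cρ) > -1) :
    0 < 1 - θ ∧ |Real.log (1 - θ)| ≤ Cθ * |ρ| * x := by
  set k := α / (σ ^ 2 + Cρ) with hk
  have hθk : 1 - θ = 1 + k * (1 - Real.exp (ρ * x)) := by
    rw [hθ, hk]; ring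
  have ht : ρ * x < 0 := mul_neg_of_neg_of_pos hρ hx
  have hu : 0 < 1 - Real.exp (ρ * x) := sub_pos.mpr (Real.exp_lt_one_iff.mpr ht)
  have hut : 1 - Real.exp (ρ * x) ≤ -(ρ * x) := by
    linarith [Real.add_one_le_exp (ρ * x)]
  have hexp : Real.exp (ρ * x) < 1 - θ := by
    rw [hθk]; nlinarith
  have hpos : 0 < 1 - θ := (Real.exp_pos _).trans hexp
  have hkC : k ≤ Cθ := by
    rw [hCθ, hk]
    refine le_trans ?_ (le_max_left _ _)
    calc α / (σ ^ 2 + Cρ) ≤ |α| / (σ ^ 2 + Cρ) := by gcongr; exact le_abs_self α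
      _ ≤ |α| / Cρ := by gcongr; exact le_add_of_nonneg_left (sq_nonneg σ)
  have hC1 : 1 ≤ Cθ := hCθ ▸ le_max_right _ _
  have hlower : ρ * x < Real.log (1 - θ) := (Real.lt_log_iff_exp_lt hpos).mpr hexp
  have hupper : Real.log (1 - θ) ≤ k * (1 - Real.exp (ρ * x)) := by
    linarith [Real.log_le_sub_one_of_pos hpos]
  have hbound : k * (1 - Real.exp (ρ * x)) ≤ Cθ * -(ρ * x) :=
    mul_le_mul hkC hut hu.le (by linarith)
  refine ⟨hpos, ?_⟩
  rw [abs_of_neg hρ, abs_le]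
  constructor <;> nlinarith
end

section
/- Let α ∈ ℝ and C_ρ > 0, and define f_u : ℝ → ℝ by f_u(r) := α·r/(r² + C_ρ). Then for every σ ≥ 0, every z > 0 and every e with 0 < e ≤ 1, one has |f_u(√(σ² + z·e)) − f_u(σ)| ≤ (|α|/C_ρ)·√z and also |f_u(√(σ² + z·e)) − f_u(σ)| ≤ |α|/√C_ρ; in particular |f_u(r)| ≤ |α|/(2√C_ρ) for every r ∈ ℝ. -/
theorem abs_div_sq_add_le {c : ℝ} (hc : 0 < c) (r : ℝ) :
    |r / (r ^ 2 + c)| ≤ 1 / (2 * √c) := by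
  have hs : 0 < √c := Real.sqrt_pos.2 hc
  have hsq : √c ^ 2 = c := Real.sq_sqrt hc.le
  have hd : 0 < r ^ 2 + c := by positivity
  rw [abs_div, abs_of_pos hd, div_le_div_iff₀ hd (by positivity)]
  nlinarith [sq_nonneg (|r| - √c), sq_abs r]

theorem abs_div_sq_add_sub_le {c : ℝ} (hc : 0 < c) (a b : ℝ) :
    |a / (a ^ 2 + c) - b / (b ^ 2 + c)| ≤ |a - b| / c := by
  have ha : 0 < a ^ 2 + c := by positivity
  have hb : 0 < b ^ 2 + c := by positivity
  have hfactor : a / (a ^ 2 + c) - b / (b ^ 2 + c) =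
      (a - b) * ((c - a * b) / ((a ^ 2 + c) * (b ^ 2 + c))) := by
    field_simp
    ring
  have hslope : |(c - a * b) / ((a ^ 2 + c) * (b ^ 2 + c))| ≤ 1 / c := by
    rw [abs_div, abs_of_pos (mul_pos ha hb), div_le_div_iff₀ (mul_pos ha hb) hc,
      ← abs_of_pos hc, ← abs_mul, abs_of_pos hc, abs_le]
    constructor <;>
      nlinarith [mul_nonneg hc.le (sq_nonneg (a - b)), mul_nonneg hc.le (sq_nonneg (a + b)),
        mul_nonneg hc.le (sq_nonneg a), mul_nonneg hc.le (sq_nonneg b), sq_nonneg (a * b),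
        sq_nonneg c]
  rw [hfactor, abs_mul, div_eq_mul_one_div |a - b| c]
  exact mul_le_mul_of_nonneg_left hslope (abs_nonneg _)

theorem abs_sqrt_sq_add_sub_le {x y : ℝ} (hx : 0 ≤ x) (hy : 0 ≤ y) :
    |√(x ^ 2 + y) - x| ≤ √y := by
  have hle : x ≤ √(x ^ 2 + y) := Real.le_sqrt_of_sq_le (by linarith)
  rw [abs_of_nonneg (sub_nonneg.2 hle), sub_le_iff_le_add, Real.sqrt_le_left (by positivity)]
  nlinarith [Real.sq_sqrt hy, mul_nonneg hx (Real.sqrt_nonneg y)]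


/-- Deterministic estimates for the Malliavin derivative of `u_s = f_u(σ_s)` with
`f_u(r) = αr/(r² + C_ρ)`: for `σ ≥ 0`, `z > 0` and `0 < e ≤ 1`,
`|f_u(√(σ² + z·e)) - f_u(σ)| ≤ (|α|/C_ρ)√z` and `≤ |α|/√C_ρ`; and
`|f_u(r)| ≤ |α|/(2√C_ρ)` for all `r`. -/
theorem stmt_10 (α Cρ : ℝ) (hCρ : 0 < Cρ) (fu : ℝ → ℝ)
    (hfu : ∀ r, fu r = α * r / (r ^ 2 + Cρ)) :
    (∀ σ z e : ℝ, 0 ≤ σ → 0 < z → 0 < e → e ≤ 1 →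
      |fu (Real.sqrt (σ ^ 2 + z * e)) - fu σ| ≤ |α| / Cρ * Real.sqrt z ∧
      |fu (Real.sqrt (σ ^ 2 + z * e)) - fu σ| ≤ |α| / Real.sqrt Cρ) ∧
    ∀ r : ℝ, |fu r| ≤ |α| / (2 * Real.sqrt Cρ) := by
  have hbound : ∀ r : ℝ, |fu r| ≤ |α| / (2 * √Cρ) := fun r => by
    rw [hfu, mul_div_assoc, abs_mul, div_eq_mul_one_div |α|]
    exact mul_le_mul_of_nonneg_left (abs_div_sq_add_le hCρ r) (abs_nonneg α)
  refine ⟨fun σ z e hσ hz he he1 => ⟨?_, ?_⟩, hbound⟩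
  · have hstep : |√(σ ^ 2 + z * e) - σ| ≤ √z :=
      (abs_sqrt_sq_add_sub_le hσ (by positivity)).trans
        (Real.sqrt_le_sqrt (mul_le_of_le_one_right hz.le he1))
    rw [hfu, hfu, mul_div_assoc, mul_div_assoc, ← mul_sub, abs_mul, div_mul_eq_mul_div,
      mul_div_assoc]
    refine mul_le_mul_of_nonneg_left ?_ (abs_nonneg α)
    exact (abs_div_sq_add_sub_le hCρ _ _).trans (div_le_div_of_nonneg_right hstep hCρ.le)
  · calc |fu √(σ ^ 2 + z * e) - fu σ| ≤ |fu √(σ ^ 2 + z * e)| + |fu σ| := abs_sub _ _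
      _ ≤ |α| / (2 * √Cρ) + |α| / (2 * √Cρ) := add_le_add (hbound _) (hbound _)
      _ = |α| / √Cρ := by ring
end
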